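/- Constrained maximizer of the tilted binary entropy: let θ ∈ (0,1), R ∈ (0, log 2), β = log((1−θ)/θ), and assume θ ≤ 1 − δ_GV(R). Then for every q ∈ [0,1] with h(q) ≥ log 2 − R, one has h(q) − q·β ≤ h(q*) − q*·β, where q* = max{θ, δ_GV(R)}; i.e., the maximum of h(q) − q·β over {q : R ≥ log 2 − h(q)} is attained at q = max{θ, δ_GV(R)}. -/

import Mathlib

/-- The binary entropy function `h(p) = −p log p − (1−p) log(1−p)` (natural log;
`Real.log 0 = 0` realizes the convention `0 log 0 = 0`). -/
noncomputable def binEnt (p : ℝ) : ℝ :=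
  -p * Real.log p - (1 - p) * Real.log (1 - p)

theorem binEnt_eq_binEntropy (p : ℝ) : binEnt p = Real.binEntropy p := by
  simp only [binEnt, Real.binEntropy, Real.log_inv]
  ring

theorem mul_log_sub_mul_log_le {q t : ℝ} (hq : 0 ≤ q) (ht : 0 < t) :
    q * Real.log t - q * Real.log q ≤ t - q := by
  rcases hq.eq_or_lt with rfl | hq
  · simpa using ht.le
  · have h := mul_le_mul_of_nonneg_left (Real.log_le_sub_one_of_pos (div_pos ht hq)) hq.le
    rw [Real.log_div ht.ne' hq.ne', mul_sub, mul_sub, mul_div_cancel₀ _ hq.ne'] at h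
    linarith

/-- The graph of the binary entropy lies below its tangent line at `t`. -/
theorem binEnt_le_tangent {q t : ℝ} (hq : q ∈ Set.Icc (0 : ℝ) 1) (ht : t ∈ Set.Ioo (0 : ℝ) 1) :
    binEnt q ≤ binEnt t + (q - t) * Real.log ((1 - t) / t) := by
  have h₁ := mul_log_sub_mul_log_le hq.1 ht.1
  have h₂ := mul_log_sub_mul_log_le (sub_nonneg.2 hq.2) (sub_pos.2 ht.2)
  rw [Real.log_div (sub_pos.2 ht.2).ne' ht.1.ne']
  simp only [binEnt]
  linarith

/-- **Constrained maximizer of the tilted binary entropy.** Let `θ ∈ (0,1)`,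
`R ∈ (0, log 2)`, `β = log((1−θ)/θ)`, `δ_GV(R) ∈ [0,1/2]` with
`h(δ_GV(R)) = log 2 − R`, and assume `θ ≤ 1 − δ_GV(R)`. Then for every `q ∈ [0,1]`
with `h(q) ≥ log 2 − R` one has `h(q) − q·β ≤ h(q*) − q*·β`, where
`q* = max{θ, δ_GV(R)}`. -/
theorem tilted_entropy_constrained_maximizer
    (θ R : ℝ) (hθ : θ ∈ Set.Ioo (0 : ℝ) 1) (hR : R ∈ Set.Ioo (0 : ℝ) (Real.log 2))
    (β : ℝ) (hβ : β = Real.log ((1 - θ) / θ))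
    (δGV : ℝ) (hδ : δGV ∈ Set.Icc (0 : ℝ) (1 / 2))
    (hGV : binEnt δGV = Real.log 2 - R)
    (hθδ : θ ≤ 1 - δGV) :
    ∀ q ∈ Set.Icc (0 : ℝ) 1, Real.log 2 - R ≤ binEnt q →
      binEnt q - q * β ≤ binEnt (max θ δGV) - max θ δGV * β := by
  intro q hq hhq
  rcases le_or_gt δGV θ with h | h
  · rw [max_eq_left h]
    have := binEnt_le_tangent hq hθ
    rw [← hβ] at this
    linarith
  · rw [max_eq_right h.le]
    have hδ₀ : 0 < δGV := hθ.1.trans h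
    have hδ₁ : δGV < 1 := by linarith [hδ.2]
    have hδq : δGV ≤ q := by
      by_contra! hlt
      have hδ₂ : δGV ≤ 2⁻¹ := by linarith [hδ.2]
      have := Real.binEntropy_strictMonoOn ⟨hq.1, hlt.le.trans hδ₂⟩ ⟨hδ.1, hδ₂⟩ hlt
      rw [← binEnt_eq_binEntropy, ← binEnt_eq_binEntropy] at this
      linarith
    have htangent := binEnt_le_tangent hq ⟨hδ₀, hδ₁⟩
    have hslope : Real.log ((1 - δGV) / δGV) ≤ β := by
      rw [hβ]
      refine Real.log_le_log (div_pos (sub_pos.2 hδ₁) hδ₀) ?_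
      exact div_le_div₀ (sub_pos.2 hθ.2).le (by linarith) hθ.1 h.le
    have := mul_le_mul_of_nonneg_left hslope (sub_nonneg.2 hδq)
    linarith
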